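/- Let n ≥ 1 and let I be the two-sided ideal of the free algebra A = FreeAlgebra K (Fin n) on generators x_1, …, x_n generated by the commutators {x_j*x_i − x_i*x_j : 1 ≤ i < j ≤ n}. Let ≺ be the length-left-lexicographic order on FreeMonoid (Fin n) determined by the generator order x_n ≻ x_{n−1} ≻ ⋯ ≻ x_1 (words are compared first by length, then left-lexicographically). Then the ideal generated by tip(I) equals the ideal generated by {x_j*x_i : 1 ≤ i < j ≤ n}; equivalently, the commutators form a quadratic Gröbner basis of I with respect to ≺, so the commutative polynomial ring A/I is a strong Koszul algebra. -/

import Mathlib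

open scoped TensorProduct

noncomputable section

/-- The embedding of words into the free algebra, sending a word to the product of the
corresponding generators. -/
def wordEmb (K : Type*) [Field K] (σ : Type*) : FreeMonoid σ →* FreeAlgebra K σ :=
  FreeMonoid.lift (FreeAlgebra.ι K)

/-- The coefficient function of an element of the free algebra with respect to the word basis. -/
def coeffw (K : Type*) [Field K] (σ : Type*) (x : FreeAlgebra K σ) : FreeMonoid σ →₀ K :=
  (FreeAlgebra.basisFreeMonoid K σ).repr x

/-- A `K`-submodule of the free algebra is a two-sided ideal if it is closed under
left and right multiplication by arbitrary elements. -/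
def IsIdeal2 (K : Type*) [Field K] (σ : Type*) (I : Submodule K (FreeAlgebra K σ)) : Prop :=
  ∀ a b : FreeAlgebra K σ, ∀ x ∈ I, a * x * b ∈ I

/-- The two-sided ideal generated by a set `S`. -/
def idealGen (K : Type*) [Field K] (σ : Type*) (S : Set (FreeAlgebra K σ)) :
    Submodule K (FreeAlgebra K σ) :=
  Submodule.span K {x | ∃ a s b, s ∈ S ∧ x = a * s * b}

/-- `lt` is an admissible order on `FreeMonoid σ`: a well-order compatible with
multiplication on both sides, and such that a word is ≤ any word containing it as a factor. -/
structure IsAdmissibleOrder {σ : Type*} (lt : FreeMonoid σ → FreeMonoid σ → Prop) : Prop where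
  isWellOrder : IsWellOrder (FreeMonoid σ) lt
  mul_right : ∀ p q r : FreeMonoid σ, lt p q → lt (p * r) (q * r)
  mul_left : ∀ p q s : FreeMonoid σ, lt p q → lt (s * p) (s * q)
  le_mul : ∀ q r s : FreeMonoid σ, q = r * q * s ∨ lt q (r * q * s)

/-- A length admissible order is an admissible order in which longer words are larger. -/
structure IsLengthAdmissibleOrder {σ : Type*} (lt : FreeMonoid σ → FreeMonoid σ → Prop)
    extends IsAdmissibleOrder lt : Prop where
  length_lt : ∀ p q : FreeMonoid σ, p.length < q.length → lt p q

/-- `t` is the tip (the largest word of the support with respect to `lt`) of `x`. -/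
def IsTipOf (K : Type*) [Field K] {σ : Type*} (lt : FreeMonoid σ → FreeMonoid σ → Prop)
    (t : FreeMonoid σ) (x : FreeAlgebra K σ) : Prop :=
  coeffw K σ x t ≠ 0 ∧ ∀ u, coeffw K σ x u ≠ 0 → u = t ∨ lt u t

/-- The set of tips of the nonzero elements of `S`. -/
def tipSet (K : Type*) [Field K] {σ : Type*} (lt : FreeMonoid σ → FreeMonoid σ → Prop)
    (S : Set (FreeAlgebra K σ)) : Set (FreeMonoid σ) :=
  {t | ∃ x ∈ S, IsTipOf K lt t x}

/-- The set of nontips of `S`: words which are not a tip of an element of `S`. -/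
def nontipSet (K : Type*) [Field K] {σ : Type*} (lt : FreeMonoid σ → FreeMonoid σ → Prop)
    (S : Set (FreeAlgebra K σ)) : Set (FreeMonoid σ) :=
  {w | w ∉ tipSet K lt S}

/-- `G` is a Gröbner basis of the two-sided ideal `I` with respect to `lt`. -/
def IsGrobnerBasis (K : Type*) [Field K] {σ : Type*}
    (lt : FreeMonoid σ → FreeMonoid σ → Prop) (G : Set (FreeAlgebra K σ))
    (I : Submodule K (FreeAlgebra K σ)) : Prop :=
  G ⊆ ↑I ∧ idealGen K σ (wordEmb K σ '' tipSet K lt G) = idealGen K σ (wordEmb K σ '' tipSet K lt ↑I)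

/-- `x` is homogeneous of degree `d`: every word in its support has length `d`. -/
def IsHomogOfDeg (K : Type*) [Field K] {σ : Type*} (x : FreeAlgebra K σ) (d : ℕ) : Prop :=
  ∀ w : FreeMonoid σ, coeffw K σ x w ≠ 0 → w.length = d


/-- The length-left-lexicographic order on words over a linearly ordered alphabet. -/
def llexLt {σ : Type*} [LinearOrder σ] (p q : FreeMonoid σ) : Prop :=
  p.length < q.length ∨
    (p.length = q.length ∧ List.Lex (· < ·) (FreeMonoid.toList p) (FreeMonoid.toList q))

theorem basis_eq_wordEmb (K : Type*) [Field K] (σ : Type*) (w : FreeMonoid σ) :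
    FreeAlgebra.basisFreeMonoid K σ w = wordEmb K σ w := by
  simp [FreeAlgebra.basisFreeMonoid, wordEmb, FreeAlgebra.equivMonoidAlgebraFreeMonoid]

theorem coeffw_wordEmb (K : Type*) [Field K] (σ : Type*) (w : FreeMonoid σ) :
    coeffw K σ (wordEmb K σ w) = Finsupp.single w 1 := by
  rw [← basis_eq_wordEmb, coeffw, Module.Basis.repr_self]

theorem coeffw_comm (K : Type*) [Field K] (σ : Type*) (i j : σ) :
    coeffw K σ (FreeAlgebra.ι K j * FreeAlgebra.ι K i - FreeAlgebra.ι K i * FreeAlgebra.ι K j)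
      = Finsupp.single (FreeMonoid.of j * FreeMonoid.of i) 1
        - Finsupp.single (FreeMonoid.of i * FreeMonoid.of j) 1 := by
  rw [← coeffw_wordEmb, ← coeffw_wordEmb]
  simp [coeffw, wordEmb]

theorem idealGen_le (K : Type*) [Field K] (σ : Type*) (S T : Set (FreeAlgebra K σ))
    (h : ∀ s ∈ S, ∃ a t b, t ∈ T ∧ s = a * t * b) : idealGen K σ S ≤ idealGen K σ T := by
  refine Submodule.span_mono ?_
  rintro x ⟨a, s, b, hs, rfl⟩
  obtain ⟨a', t, b', ht, rfl⟩ := h s hs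
  exact ⟨a * a', t, b' * b, ht, by simp only [mul_assoc]⟩

theorem sorted_lex_min {σ : Type*} [LinearOrder σ] (t : List σ) :
    ∀ u : List σ, t.Pairwise (· ≤ ·) → u.Perm t → List.Lex (· < ·) u t → False := by
  induction t with
  | nil => intro u _ _ h; cases h
  | cons b t ih =>
    intro u hs hp hl
    cases hl with
    | nil => simp at hp
    | cons h => exact ih _ (List.pairwise_cons.1 hs).2 hp.cons_inv h
    | @rel a _ l1 _ h =>
      have ha : a ∈ b :: t := hp.subset (by simp)
      rcases List.mem_cons.1 ha with rfl | ha
      · exact lt_irrefl _ h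
      · exact absurd h (not_lt.2 ((List.pairwise_cons.1 hs).1 a ha))

/-- Abelianization of the free algebra. -/
def abel (K : Type*) [Field K] (σ : Type*) : FreeAlgebra K σ →ₐ[K] MvPolynomial σ K :=
  FreeAlgebra.lift K MvPolynomial.X

theorem abel_wordEmb (K : Type*) [Field K] (σ : Type*) [DecidableEq σ] (w : FreeMonoid σ) :
    abel K σ (wordEmb K σ w)
      = MvPolynomial.monomial (Multiset.toFinsupp (w.toList : Multiset σ)) 1 := by
  induction w using FreeMonoid.inductionOn' with
  | one => simp [wordEmb]
  | of_mul x xs ih =>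
    rw [map_mul, map_mul, ih]
    have : ((FreeMonoid.of x * xs).toList : Multiset σ) = {x} + (xs.toList : Multiset σ) := by
      simp [FreeMonoid.toList_of_mul]
    rw [this, map_add]
    simp [wordEmb, abel, MvPolynomial.X, MvPolynomial.monomial_mul]

theorem abel_idealGen (K : Type*) [Field K] (σ : Type*) (S : Set (FreeAlgebra K σ))
    (hS : ∀ s ∈ S, abel K σ s = 0) (x) (hx : x ∈ idealGen K σ S) : abel K σ x = 0 := by
  have : idealGen K σ S ≤ LinearMap.ker (abel K σ).toLinearMap := by
    refine Submodule.span_le.2 ?_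
    rintro y ⟨a, s, b, hs, rfl⟩
    simp [hS s hs]
  simpa using this hx

theorem tip_not_sorted (K : Type*) [Field K] (σ : Type*) [LinearOrder σ] (x : FreeAlgebra K σ)
    (hx : abel K σ x = 0) (t : FreeMonoid σ) (ht : IsTipOf K llexLt t x) :
    ¬ t.toList.Pairwise (· ≤ ·) := by
  intro hs
  obtain ⟨h0, hmax⟩ := ht
  apply h0
  have hexp : x = (coeffw K σ x).sum fun u c => c • wordEmb K σ u := by
    conv_lhs => rw [← (FreeAlgebra.basisFreeMonoid K σ).linearCombination_repr x]
    rw [Finsupp.linearCombination_apply]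
    simp only [basis_eq_wordEmb]
    rfl
  have h1 : MvPolynomial.coeff (Multiset.toFinsupp (t.toList : Multiset σ)) (abel K σ x) = 0 := by
    rw [hx]; simp
  rw [hexp, Finsupp.sum, map_sum, MvPolynomial.coeff_sum, Finset.sum_eq_single t] at h1
  · simpa [abel_wordEmb] using h1
  · intro u hu hut
    rw [map_smul, abel_wordEmb, MvPolynomial.coeff_smul, MvPolynomial.coeff_monomial, if_neg]
    · simp
    · intro he
      have hp : u.toList.Perm t.toList := Multiset.coe_eq_coe.1 (Multiset.toFinsupp.injective he)
      rcases hmax u (Finsupp.mem_support_iff.1 hu) with h | h | h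
      · exact hut h
      · exact absurd hp.length_eq (ne_of_lt h)
      · exact sorted_lex_min _ _ hs hp h.2
  · intro hn
    rw [Finsupp.notMem_support_iff.1 hn]; simp

theorem tip_factor (K : Type*) [Field K] (σ : Type*) [LinearOrder σ] (x : FreeAlgebra K σ)
    (hx : abel K σ x = 0) (t : FreeMonoid σ) (ht : IsTipOf K llexLt t x) :
    ∃ i j : σ, i < j ∧ ∃ u v : FreeMonoid σ,
      t = u * (FreeMonoid.of j * FreeMonoid.of i) * v := by
  have h := tip_not_sorted K σ x hx t ht
  rw [← List.isChain_iff_pairwise, List.isChain_iff_forall_rel_of_append_cons_cons] at h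
  push Not at h
  obtain ⟨a, b, l1, l2, h, hab⟩ := h
  refine ⟨b, a, hab, FreeMonoid.ofList l1, FreeMonoid.ofList l2, ?_⟩
  apply FreeMonoid.toList.injective
  rw [h]
  simp [FreeMonoid.toList_mul]

theorem comm_tip (K : Type*) [Field K] (σ : Type*) [LinearOrder σ] (i j : σ) (hij : i < j) :
    IsTipOf K llexLt (FreeMonoid.of j * FreeMonoid.of i)
      (FreeAlgebra.ι K j * FreeAlgebra.ι K i - FreeAlgebra.ι K i * FreeAlgebra.ι K j) := by
  have hne : FreeMonoid.of i * FreeMonoid.of j ≠ FreeMonoid.of j * FreeMonoid.of i := by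
    intro h
    have := congrArg FreeMonoid.toList h
    simp [FreeMonoid.toList_mul] at this
    exact hij.ne this.1
  constructor
  · rw [coeffw_comm]
    simp [Finsupp.single_eq_of_ne hne.symm]
  · intro u hu
    rw [coeffw_comm] at hu
    by_cases h1 : u = FreeMonoid.of j * FreeMonoid.of i
    · exact Or.inl h1
    · right
      have h2 : u = FreeMonoid.of i * FreeMonoid.of j := by
        by_contra h2
        apply hu
        simp [Finsupp.single_eq_of_ne h1, Finsupp.single_eq_of_ne h2]
      subst h2
      right
      refine ⟨by simp, ?_⟩
      simp only [FreeMonoid.toList_mul, FreeMonoid.toList_of, List.singleton_append]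
      exact List.Lex.rel hij

theorem comm_homog (K : Type*) [Field K] (σ : Type*) (i j : σ) :
    IsHomogOfDeg K
      (FreeAlgebra.ι K j * FreeAlgebra.ι K i - FreeAlgebra.ι K i * FreeAlgebra.ι K j) 2 := by
  intro w hw
  rw [coeffw_comm] at hw
  by_cases h1 : w = FreeMonoid.of j * FreeMonoid.of i
  · subst h1; simp
  · by_cases h2 : w = FreeMonoid.of i * FreeMonoid.of j
    · subst h2; simp
    · exact absurd (by simp [Finsupp.single_eq_of_ne h1, Finsupp.single_eq_of_ne h2]) hw

/-- the commutators form a quadratic Gröbner basis of the commutation ideal with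
respect to the length-left-lexicographic order, with tip ideal generated by
`{x_j x_i : i < j}`. -/
theorem stmt14 (K : Type*) [Field K] (n : ℕ) (hn : 1 ≤ n)
    (I : Submodule K (FreeAlgebra K (Fin n)))
    (hI : I = idealGen K (Fin n) {c | ∃ i j : Fin n, i < j ∧
      c = FreeAlgebra.ι K j * FreeAlgebra.ι K i - FreeAlgebra.ι K i * FreeAlgebra.ι K j}) :
    idealGen K (Fin n)
        (wordEmb K (Fin n) '' tipSet K llexLt (I : Set (FreeAlgebra K (Fin n))))
      = idealGen K (Fin n) (wordEmb K (Fin n) ''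
        {w | ∃ i j : Fin n, i < j ∧ w = FreeMonoid.of j * FreeMonoid.of i}) ∧
    IsGrobnerBasis K llexLt {c | ∃ i j : Fin n, i < j ∧
      c = FreeAlgebra.ι K j * FreeAlgebra.ι K i - FreeAlgebra.ι K i * FreeAlgebra.ι K j} I ∧
    (∀ c : FreeAlgebra K (Fin n), (∃ i j : Fin n, i < j ∧
      c = FreeAlgebra.ι K j * FreeAlgebra.ι K i - FreeAlgebra.ι K i * FreeAlgebra.ι K j) →
      IsHomogOfDeg K c 2) := by
  have hG : {c | ∃ i j : Fin n, i < j ∧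
      c = FreeAlgebra.ι K j * FreeAlgebra.ι K i - FreeAlgebra.ι K i * FreeAlgebra.ι K j}
      ⊆ (I : Set (FreeAlgebra K (Fin n))) := by
    intro c hc
    rw [hI]
    exact Submodule.subset_span ⟨1, c, 1, hc, by simp⟩
  have hI0 : ∀ x ∈ I, abel K (Fin n) x = 0 := by
    intro x hx
    rw [hI] at hx
    refine abel_idealGen K _ _ ?_ x hx
    rintro s ⟨i, j, _, rfl⟩
    simp [mul_comm]
  have h1 : idealGen K (Fin n)
        (wordEmb K (Fin n) '' tipSet K llexLt (I : Set (FreeAlgebra K (Fin n))))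
      ≤ idealGen K (Fin n) (wordEmb K (Fin n) ''
        {w | ∃ i j : Fin n, i < j ∧ w = FreeMonoid.of j * FreeMonoid.of i}) := by
    apply idealGen_le
    rintro _ ⟨t, ⟨x, hx, ht⟩, rfl⟩
    obtain ⟨i, j, hij, u, v, rfl⟩ := tip_factor K _ x (hI0 x hx) t ht
    exact ⟨wordEmb K _ u, _, wordEmb K _ v, ⟨_, ⟨i, j, hij, rfl⟩, rfl⟩, by simp only [map_mul]⟩
  have h2 : idealGen K (Fin n) (wordEmb K (Fin n) ''
        {w | ∃ i j : Fin n, i < j ∧ w = FreeMonoid.of j * FreeMonoid.of i})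
      ≤ idealGen K (Fin n) (wordEmb K (Fin n) '' tipSet K llexLt {c | ∃ i j : Fin n, i < j ∧
        c = FreeAlgebra.ι K j * FreeAlgebra.ι K i
          - FreeAlgebra.ι K i * FreeAlgebra.ι K j}) := by
    apply idealGen_le
    rintro _ ⟨_, ⟨i, j, hij, rfl⟩, rfl⟩
    exact ⟨1, _, 1, ⟨_, ⟨_, ⟨i, j, hij, rfl⟩, comm_tip K _ i j hij⟩, rfl⟩, by simp⟩
  have h3 : idealGen K (Fin n) (wordEmb K (Fin n) '' tipSet K llexLt {c | ∃ i j : Fin n, i < j ∧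
        c = FreeAlgebra.ι K j * FreeAlgebra.ι K i
          - FreeAlgebra.ι K i * FreeAlgebra.ι K j})
      ≤ idealGen K (Fin n)
        (wordEmb K (Fin n) '' tipSet K llexLt (I : Set (FreeAlgebra K (Fin n)))) := by
    apply idealGen_le
    rintro _ ⟨t, ⟨x, hx, ht⟩, rfl⟩
    exact ⟨1, _, 1, ⟨t, ⟨x, hG hx, ht⟩, rfl⟩, by simp⟩
  refine ⟨le_antisymm h1 (h2.trans h3), ⟨hG, le_antisymm h3 (h1.trans h2)⟩, ?_⟩
  rintro c ⟨i, j, _, rfl⟩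
  exact comm_homog K _ i j
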